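/- arXiv:1601.02084 — 4 statements merged into one kernel-verified Lean document; each statement's English description precedes it below -/
import Mathlib

section
/- Let a, b ∈ ℝ. If x, y, z, w ∈ ℂ are such that the four partial derivatives ∂F/∂x, ∂F/∂y, ∂F/∂z, ∂F/∂w of F all vanish at the point (x, y, z, w, 0) (i.e. with t = 0), then x = y = z = w = 0. -/
/-- The auxiliary cubic `φ_c(u,v,t) = (u+v)^3 + 3uv(u+v) + c t^3`. -/
noncomputable def phi (c u v t : ℂ) : ℂ := (u + v) ^ 3 + 3 * u * v * (u + v) + c * t ^ 3

/-- The quintic `F = xw φ_a(x,w,t) - yz φ_b(y,z,t)`. -/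
noncomputable def F (a b : ℝ) (x y z w t : ℂ) : ℂ :=
  x * w * phi (a : ℂ) x w t - y * z * phi (b : ℂ) y z t

/-- The binary quintic `uv(u+v)(u²+5uv+v²)` has no repeated linear factor: its two partial
derivatives vanish simultaneously only at the origin. -/
theorem eq_zero_of_quintic_partials_eq_zero {u v : ℂ}
    (hu : 4 * u ^ 3 * v + 18 * u ^ 2 * v ^ 2 + 12 * u * v ^ 3 + v ^ 4 = 0)
    (hv : u ^ 4 + 12 * u ^ 3 * v + 18 * u ^ 2 * v ^ 2 + 4 * u * v ^ 3 = 0) : u = 0 ∧ v = 0 := by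
  have hu7 : u ^ 7 = 0 := by
    linear_combination
      (-556 / 105 * u ^ 3 - 208 / 21 * u ^ 2 * v - 16 / 7 * u * v ^ 2) * hu +
      (u ^ 3 + 964 / 105 * u ^ 2 * v + 142 / 21 * u * v ^ 2 + 4 / 7 * v ^ 3) * hv
  have hv7 : v ^ 7 = 0 := by
    linear_combination
      (-556 / 105 * v ^ 3 - 208 / 21 * v ^ 2 * u - 16 / 7 * v * u ^ 2) * hv +
      (v ^ 3 + 964 / 105 * v ^ 2 * u + 142 / 21 * v * u ^ 2 + 4 / 7 * u ^ 3) * hu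
  exact ⟨pow_eq_zero_iff (by norm_num) |>.mp hu7, pow_eq_zero_iff (by norm_num) |>.mp hv7⟩

/-- The derivative of a quartic polynomial function. -/
theorem deriv_quartic (m p q r l x : ℂ) :
    deriv (fun s => m + p * s + q * s ^ 2 + r * s ^ 3 + l * s ^ 4) x =
      p + 2 * q * x + 3 * r * x ^ 2 + 4 * l * x ^ 3 := by
  have h := ((((hasDerivAt_const x m).add ((hasDerivAt_id x).const_mul p)).add
    ((hasDerivAt_pow 2 x).const_mul q)).add ((hasDerivAt_pow 3 x).const_mul r)).add
    ((hasDerivAt_pow 4 x).const_mul l)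
  refine h.deriv.trans ?_
  push_cast
  ring

/-- The hypersurface `F = 0` has no singular points at `t = 0`. -/
theorem no_singular_points_at_t_eq_zero (a b : ℝ) (x y z w : ℂ)
    (hx : deriv (fun s => F a b s y z w 0) x = 0)
    (hy : deriv (fun s => F a b x s z w 0) y = 0)
    (hz : deriv (fun s => F a b x y s w 0) z = 0)
    (hw : deriv (fun s => F a b x y z s 0) w = 0) :
    x = 0 ∧ y = 0 ∧ z = 0 ∧ w = 0 := by
  have hx_fun : (fun s => F a b s y z w 0) = fun s => -(y * z * phi b y z 0) + w ^ 4 * s +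
      6 * w ^ 3 * s ^ 2 + 6 * w ^ 2 * s ^ 3 + w * s ^ 4 := by
    funext s
    simp only [F, phi]
    ring
  have hy_fun : (fun s => F a b x s z w 0) = fun s => x * w * phi a x w 0 + (-(z ^ 4)) * s +
      (-(6 * z ^ 3)) * s ^ 2 + (-(6 * z ^ 2)) * s ^ 3 + (-z) * s ^ 4 := by
    funext s
    simp only [F, phi]
    ring
  have hz_fun : (fun s => F a b x y s w 0) = fun s => x * w * phi a x w 0 + (-(y ^ 4)) * s +
      (-(6 * y ^ 3)) * s ^ 2 + (-(6 * y ^ 2)) * s ^ 3 + (-y) * s ^ 4 := by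
    funext s
    simp only [F, phi]
    ring
  have hw_fun : (fun s => F a b x y z s 0) = fun s => -(y * z * phi b y z 0) + x ^ 4 * s +
      6 * x ^ 3 * s ^ 2 + 6 * x ^ 2 * s ^ 3 + x * s ^ 4 := by
    funext s
    simp only [F, phi]
    ring
  rw [hx_fun, deriv_quartic] at hx
  rw [hy_fun, deriv_quartic] at hy
  rw [hz_fun, deriv_quartic] at hz
  rw [hw_fun, deriv_quartic] at hw
  obtain ⟨hx0, hw0⟩ := eq_zero_of_quintic_partials_eq_zero (u := x) (v := w)
    (by linear_combination hx) (by linear_combination hw)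
  obtain ⟨hy0, hz0⟩ := eq_zero_of_quintic_partials_eq_zero (u := y) (v := z)
    (by linear_combination -hy) (by linear_combination -hz)
  exact ⟨hx0, hy0, hz0, hw0⟩
end

section
/- Let a, b ∈ ℝ and x, y, z, w ∈ ℂ with x·w ≠ 0. If ∂F/∂x and ∂F/∂w both vanish at (x, y, z, w, 1), then either (x = w and 35x³ + a = 0), or ((x+w)² + x·w = 0 and 5(x+w)³ = a). -/
/-- The derivative of the product `u * φ_c(u,v,1) * v` in `u`, up to an additive constant. -/
theorem hasDerivAt_mul_phi (c v k u : ℂ) :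
    HasDerivAt (fun s => s * v * phi c s v 1 - k)
      (v * (phi c u v 1 + u * (3 * (u + v) ^ 2 + 3 * v * (u + v) + 3 * u * v))) u := by
  have hs : HasDerivAt (fun s : ℂ => s + v) 1 u := (hasDerivAt_id' u).add_const v
  have hphi := ((hs.pow 3).add
    ((((hasDerivAt_id' u).const_mul 3).mul_const v).mul hs)).add_const (c * 1 ^ 3)
  refine ((((hasDerivAt_id' u).mul_const v).mul hphi).sub_const k).congr_deriv ?_
  simp only [phi, Pi.add_apply, Pi.mul_apply, Pi.pow_apply]
  push_cast
  ring

theorem phi_comm (c u v t : ℂ) : phi c u v t = phi c v u t := by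
  unfold phi
  ring

/-- If `xw ≠ 0` and `∂F/∂x = ∂F/∂w = 0` at `(x,y,z,w,1)`, then either
`x = w` and `35x³ + a = 0`, or `(x+w)² + xw = 0` and `5(x+w)³ = a`. -/
theorem critical_point_dichotomy (a b : ℝ) (x y z w : ℂ) (hxw : x * w ≠ 0)
    (hx : deriv (fun s => F a b s y z w 1) x = 0)
    (hw : deriv (fun s => F a b x y z s 1) w = 0) :
    (x = w ∧ 35 * x ^ 3 + (a : ℂ) = 0) ∨
    ((x + w) ^ 2 + x * w = 0 ∧ 5 * (x + w) ^ 3 = (a : ℂ)) := by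
  obtain ⟨hx0, hw0⟩ := mul_ne_zero_iff.mp hxw
  have hFw : (fun s => F a b x y z s 1) =
      fun s => s * x * phi a s x 1 - y * z * phi b y z 1 := by
    funext s
    rw [F, phi_comm _ x s, mul_comm x s]
  have ex := (hasDerivAt_mul_phi a w (y * z * phi b y z 1) x).deriv.symm.trans hx
  rw [hFw, (hasDerivAt_mul_phi a x (y * z * phi b y z 1) w).deriv] at hw
  replace ex := (mul_eq_zero.mp ex).resolve_left hw0
  replace hw := (mul_eq_zero.mp hw).resolve_left hx0
  unfold phi at ex hw
  have h : (x - w) * ((x + w) ^ 2 + x * w) = 0 := by linear_combination (ex - hw) / 3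
  rcases mul_eq_zero.mp h with h | h
  · obtain rfl := sub_eq_zero.mp h
    exact Or.inl ⟨rfl, by linear_combination ex⟩
  · exact Or.inr ⟨h, by linear_combination (9 * x + 6 * w) * h - ex⟩
end

section
/- Let a, b be real with a > 0, b > 0 and a⁵ > 49·b⁵. A point (x, y, z, w) ∈ ℂ⁴ is a singular point of the affine quintic if and only if x·w = 0, y·z = 0, x·(x³+a) = 0, w·(w³+a) = 0, y·(y³+b) = 0 and z·(z³+b) = 0. -/
/-- `(x,y,z,w)` is a singular point of the affine quintic `F(·,·,·,·,1) = 0`. -/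
def IsSingularPoint (a b : ℝ) (x y z w : ℂ) : Prop :=
  F a b x y z w 1 = 0 ∧
  deriv (fun s => F a b s y z w 1) x = 0 ∧
  deriv (fun s => F a b x s z w 1) y = 0 ∧
  deriv (fun s => F a b x y s w 1) z = 0 ∧
  deriv (fun s => F a b x y z s 1) w = 0

/-- The `u`-derivative of `u v φ_c(u,v,1)`. -/
theorem hasDerivAt_mul_phi_left (c u v : ℂ) :
    HasDerivAt (fun s => s * v * phi c s v 1)
      (v * (4 * u ^ 3 + 18 * u ^ 2 * v + 12 * u * v ^ 2 + v ^ 3 + c)) u := by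
  have hs := hasDerivAt_id' u
  have h := (hs.mul_const v).mul
    ((((hs.add_const v).pow 3).add (((hs.const_mul 3).mul_const v).mul
      (hs.add_const v))).add_const (c * 1 ^ 3))
  refine h.congr_deriv ?_
  simp only [Pi.pow_apply, Pi.add_apply, Pi.mul_apply]
  push_cast
  ring

/-- The `v`-derivative of `u v φ_c(u,v,1)`. -/
theorem hasDerivAt_mul_phi_right (c u v : ℂ) :
    HasDerivAt (fun s => u * s * phi c u s 1)
      (u * (4 * v ^ 3 + 18 * v ^ 2 * u + 12 * v * u ^ 2 + u ^ 3 + c)) v := by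
  convert hasDerivAt_mul_phi_left c v u using 2 with s
  simp only [phi]
  ring

theorem isSingularPoint_iff (a b : ℝ) (x y z w : ℂ) :
    IsSingularPoint a b x y z w ↔
      x * w * phi a x w 1 = y * z * phi b y z 1 ∧
      w * (4 * x ^ 3 + 18 * x ^ 2 * w + 12 * x * w ^ 2 + w ^ 3 + a) = 0 ∧
      z * (4 * y ^ 3 + 18 * y ^ 2 * z + 12 * y * z ^ 2 + z ^ 3 + b) = 0 ∧
      y * (4 * z ^ 3 + 18 * z ^ 2 * y + 12 * z * y ^ 2 + y ^ 3 + b) = 0 ∧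
      x * (4 * w ^ 3 + 18 * w ^ 2 * x + 12 * w * x ^ 2 + x ^ 3 + a) = 0 := by
  unfold IsSingularPoint F
  rw [((hasDerivAt_mul_phi_left a x w).sub_const _).deriv,
    ((hasDerivAt_mul_phi_left b y z).const_sub _).deriv,
    ((hasDerivAt_mul_phi_right b y z).const_sub _).deriv,
    ((hasDerivAt_mul_phi_right a x w).sub_const _).deriv, sub_eq_zero, neg_eq_zero, neg_eq_zero]

/-- A critical point of `u v φ_c(u,v,1)` either lies on a coordinate axis or has one of two
possible cubes of critical values. -/
theorem mul_phi_critical {c u v : ℂ}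
    (hu : v * (4 * u ^ 3 + 18 * u ^ 2 * v + 12 * u * v ^ 2 + v ^ 3 + c) = 0)
    (hv : u * (4 * v ^ 3 + 18 * v ^ 2 * u + 12 * v * u ^ 2 + u ^ 3 + c) = 0) :
    (u * v = 0 ∧ u * (u ^ 3 + c) = 0 ∧ v * (v ^ 3 + c) = 0) ∨
      153125 * (u * v * phi c u v 1) ^ 3 = 27 * c ^ 5 ∨
      3125 * (u * v * phi c u v 1) ^ 3 = -27 * c ^ 5 := by
  by_cases hv0 : v = 0
  · subst hv0
    left
    simpa using hv
  by_cases hu0 : u = 0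
  · subst hu0
    left
    simpa using hu
  right
  replace hu := (mul_eq_zero.mp hu).resolve_left hv0
  replace hv := (mul_eq_zero.mp hv).resolve_left hu0
  have hfac : (u - v) * (u ^ 2 + 3 * u * v + v ^ 2) = 0 := by
    linear_combination (hu - hv) / 3
  rcases mul_eq_zero.mp hfac with h | h
  · left
    obtain rfl : u = v := sub_eq_zero.mp h
    have hc : c = -35 * u ^ 3 := by linear_combination hu
    subst hc
    simp only [phi]
    ring
  · right
    have hc : c = 5 * (u + v) ^ 3 := by
      linear_combination (hu + hv) / 2 - 15 / 2 * (u + v) * h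
    have hval : u * v * phi c u v 1 = -3 * (u + v) ^ 5 := by
      subst hc
      simp only [phi]
      linear_combination (3 * u * v * (u + v) + 3 * (u + v) ^ 3) * h
    rw [hval, hc]
    ring

theorem mul_phi_eq_zero_of_axis {c u v : ℂ} (h : u * v = 0) : u * v * phi c u v 1 = 0 := by
  rw [h, zero_mul]

/-- Points on the coordinate axes satisfying the axis equations are critical. -/
theorem critical_of_axis {c u v : ℂ} (huv : u * v = 0) (hv : v * (v ^ 3 + c) = 0) :
    v * (4 * u ^ 3 + 18 * u ^ 2 * v + 12 * u * v ^ 2 + v ^ 3 + c) = 0 := by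
  linear_combination hv + (4 * u ^ 2 + 18 * u * v + 12 * v ^ 2) * huv

/-- If `a, b > 0` and `a⁵ > 49 b⁵`, then `(x,y,z,w)` is a singular point of the
affine quintic iff `xw = 0`, `yz = 0`, `x(x³+a) = 0`, `w(w³+a) = 0`, `y(y³+b) = 0`
and `z(z³+b) = 0`. -/
theorem singular_point_iff (a b : ℝ) (ha : 0 < a) (hb : 0 < b)
    (hab : a ^ 5 > 49 * b ^ 5) (x y z w : ℂ) :
    IsSingularPoint a b x y z w ↔
      x * w = 0 ∧ y * z = 0 ∧
      x * (x ^ 3 + (a : ℂ)) = 0 ∧ w * (w ^ 3 + (a : ℂ)) = 0 ∧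
      y * (y ^ 3 + (b : ℂ)) = 0 ∧ z * (z ^ 3 + (b : ℂ)) = 0 := by
  rw [isSingularPoint_iff]
  constructor
  · rintro ⟨hF, hx, hy, hz, hw⟩
    have ha5 : 0 < a ^ 5 := by positivity
    have hb5 : 0 < b ^ 5 := by positivity
    have key (m n : ℝ) (h : (m : ℂ) * (a : ℂ) ^ 5 = n * (b : ℂ) ^ 5) :
        m * a ^ 5 = n * b ^ 5 := by exact_mod_cast h
    have h₁ := mul_phi_critical hx hw
    have h₂ := mul_phi_critical hy hz
    rw [hF] at h₁
    rcases h₁ with ⟨hxw, hx', hw'⟩ | h₁ | h₁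
    · rw [mul_phi_eq_zero_of_axis hxw] at hF
      rw [← hF] at h₂
      rcases h₂ with ⟨hyz, hy', hz'⟩ | h₂ | h₂
      · exact ⟨hxw, hyz, hx', hw', hy', hz'⟩
      · have := key 0 1 (by push_cast; linear_combination h₂ / 27)
        linarith
      · have := key 0 1 (by push_cast; linear_combination -h₂ / 27)
        linarith
    · rcases h₂ with ⟨hyz, -, -⟩ | h₂ | h₂
      · rw [mul_phi_eq_zero_of_axis hyz] at h₁
        have := key 1 0 (by push_cast; linear_combination -h₁ / 27)
        linarith
      · have := key 1 1 (by push_cast; linear_combination (h₂ - h₁) / 27)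
        linarith
      · have := key 1 (-49) (by push_cast; linear_combination (49 * h₂ - h₁) / 27)
        linarith
    · rcases h₂ with ⟨hyz, -, -⟩ | h₂ | h₂
      · rw [mul_phi_eq_zero_of_axis hyz] at h₁
        have := key 1 0 (by push_cast; linear_combination h₁ / 27)
        linarith
      · have := key 49 (-1) (by push_cast; linear_combination (49 * h₁ - h₂) / 27)
        linarith
      · have := key 1 1 (by push_cast; linear_combination (h₁ - h₂) / 27)
        linarith
  · rintro ⟨hxw, hyz, hx, hw, hy, hz⟩
    refine ⟨?_, critical_of_axis hxw hw, critical_of_axis hyz hz,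
      critical_of_axis (mul_comm y z ▸ hyz) hy, critical_of_axis (mul_comm x w ▸ hxw) hx⟩
    rw [mul_phi_eq_zero_of_axis hxw, mul_phi_eq_zero_of_axis hyz]
end

section
/- Let r > 0 and φ, ψ ∈ ℝ, and let p := (r·e^{iφ}, r·e^{iψ}, r·e^{−iψ}, r·e^{−iφ}) ∈ ℂ⁴, a point of the cone K. Define v₀ := (e^{iφ}, e^{iψ}, e^{−iψ}, e^{−iφ}), v₁ := (i·r·e^{iφ}, 0, 0, −i·r·e^{−iφ}), v₂ := (0, i·r·e^{iψ}, −i·r·e^{−iψ}, 0), which span the tangent space of K at p. Then: (i) p lies on the quadric Q, i.e. p₁·p₄ − p₂·p₃ = 0; (ii) Im⟨v_j, v_k⟩ = 0 for all j, k ∈ {0,1,2}, where ⟨·,·⟩ is the standard Hermitian inner product on ℂ⁴ (so K is Lagrangian for the standard symplectic form Im⟨·,·⟩ on ℂ⁴); and (iii) the determinant of the 3×3 complex matrix whose rows are the last three components (the (y,z,w)-components) of v₀, v₁, v₂, divided by the fourth coordinate r·e^{−iφ} of p, equals 2r; in particular this value is real, so the imaginary part of the holomorphic 3-form Θ = dy∧dz∧dw/w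 of the quadric Q vanishes on K. -/
open Complex

theorem conj_exp_ofReal_mul_I (t : ℝ) :
    starRingEnd ℂ (exp (t * I)) = exp (-t * I) := by
  simp [← exp_conj]

theorem conj_exp_neg_ofReal_mul_I (t : ℝ) :
    starRingEnd ℂ (exp (-t * I)) = exp (t * I) := by
  simp [← exp_conj]

theorem exp_mul_I_mul_exp_neg_mul_I (z : ℂ) : exp (z * I) * exp (-z * I) = 1 := by
  rw [← exp_add]
  simp

/-- Pointwise verification that the `T²`-cone
`K = {(x, y, ȳ, x̄) : |x| = |y|}` is a special Lagrangian cone in the quadric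
`Q = {xw = yz}` with holomorphic 3-form `Θ = dy∧dz∧dw/w`:
at the point `p = (re^{iφ}, re^{iψ}, re^{−iψ}, re^{−iφ})` with tangent vectors
`v₀, v₁, v₂`, (i) `p` lies on `Q`; (ii) the Hermitian inner products of the
`v_j` have vanishing imaginary part (`K` is Lagrangian); (iii) the determinant
of the matrix of `(y,z,w)`-components of `v₀, v₁, v₂`, divided by the fourth
coordinate of `p`, equals `2r` (so `Im Θ` vanishes on `K`). -/
theorem K_is_special_Lagrangian (r φ ψ : ℝ) (hr : 0 < r) :
    let p : Fin 4 → ℂ := ![r * exp (φ * I), r * exp (ψ * I),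
      r * exp (-ψ * I), r * exp (-φ * I)]
    let vs : Fin 3 → Fin 4 → ℂ :=
      ![![exp (φ * I), exp (ψ * I), exp (-ψ * I), exp (-φ * I)],
        ![I * r * exp (φ * I), 0, 0, -(I * r * exp (-φ * I))],
        ![0, I * r * exp (ψ * I), -(I * r * exp (-ψ * I)), 0]]
    (p 0 * p 3 - p 1 * p 2 = 0) ∧
    (∀ j k : Fin 3, (∑ i : Fin 4, starRingEnd ℂ (vs j i) * vs k i).im = 0) ∧
    (Matrix.of fun j k : Fin 3 => vs j k.succ).det / (r * exp (-φ * I)) = 2 * r := by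
  intro p vs
  have hφ := exp_mul_I_mul_exp_neg_mul_I φ
  have hψ := exp_mul_I_mul_exp_neg_mul_I ψ
  have hcφ := conj_exp_ofReal_mul_I φ
  have hcψ := conj_exp_ofReal_mul_I ψ
  have hcφ' := conj_exp_neg_ofReal_mul_I φ
  have hcψ' := conj_exp_neg_ofReal_mul_I ψ
  have hne : exp (-φ * I) ≠ 0 := exp_ne_zero _
  have hr' : (r : ℂ) ≠ 0 := ofReal_ne_zero.mpr hr.ne'
  subst p vs
  generalize exp (φ * I) = a at *
  generalize exp (-φ * I) = a' at *
  generalize exp (ψ * I) = b at *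
  generalize exp (-ψ * I) = b' at *
  refine ⟨?_, fun j k => ?_, ?_⟩
  · simp
    linear_combination (r : ℂ) ^ 2 * hφ - (r : ℂ) ^ 2 * hψ
  · rw [← conj_eq_iff_im]
    fin_cases j <;> fin_cases k <;>
      simp [Fin.sum_univ_four, hcφ, hcψ, hcφ', hcψ'] <;> ring
  · rw [div_eq_iff (mul_ne_zero hr' hne)]
    simp [Matrix.det_fin_three]
    linear_combination (-2 * (r : ℂ) ^ 2 * a' * I ^ 2) * hψ - 2 * (r : ℂ) ^ 2 * a' * I_sq
end
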